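/- arXiv:2209.04474 — 8 statements merged into one kernel-verified Lean document; each statement's English description precedes it below -/
import Mathlib

section
/- Suppose P ∈ ℝ^(X × A) satisfies the single-party no-signalling conditions (for every party i, all input tuples x, x' agreeing at every party except possibly i, and every output tuple a, ∑_{b ∈ Fin nO} P(a[i ↦ b] | x) = ∑_{b ∈ Fin nO} P(a[i ↦ b] | x')). Then the full family of no-signalling conditions holds: for every subset W ⊆ Fin N, every pair of input tuples x, x' ∈ X that agree at every party in W, and every assignment a_W : W → Fin nO of outputs to the parties in W, the sum of P(a|x) over all output tuples a ∈ A whose restriction to W equals a_W is equal to the corresponding sum of P(a|x'). In particular, for any two disjoint subsets V, W of parties, the parties in V cannot signal to those in W. -/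
open Finset

/-- The standard inner product on `ℝ^(X × A)`. -/
def ip {N nI nO : ℕ} (e P : (Fin N → Fin nI) → (Fin N → Fin nO) → ℝ) : ℝ :=
  ∑ x : Fin N → Fin nI, ∑ a : Fin N → Fin nO, e x a * P x a

/-- The single-party no-signalling conditions. -/
def NoSig (N nI nO : ℕ) (P : (Fin N → Fin nI) → (Fin N → Fin nO) → ℝ) : Prop :=
  ∀ i : Fin N, ∀ x x' : Fin N → Fin nI, (∀ j, j ≠ i → x j = x' j) →
    ∀ a : Fin N → Fin nO,
      ∑ b : Fin nO, P x (Function.update a i b) =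
      ∑ b : Fin nO, P x' (Function.update a i b)

/-- The state space of no-signalling behaviours. -/
def SNS (N nI nO : ℕ) (P : (Fin N → Fin nI) → (Fin N → Fin nO) → ℝ) : Prop :=
  NoSig N nI nO P ∧ (∀ x a, 0 ≤ P x a) ∧
    (∀ x : Fin N → Fin nI, ∑ a : Fin N → Fin nO, P x a = 1)

/-- Effect vectors: `0 ≤ ⟨e, P⟩ ≤ 1` on all no-signalling states. -/
def IsEffect (N nI nO : ℕ) (e : (Fin N → Fin nI) → (Fin N → Fin nO) → ℝ) : Prop :=
  ∀ P, SNS N nI nO P → 0 ≤ ip e P ∧ ip e P ≤ 1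

/-- Extremal effect vectors. -/
def IsExtremalEffect (N nI nO : ℕ) (e : (Fin N → Fin nI) → (Fin N → Fin nO) → ℝ) : Prop :=
  IsEffect N nI nO e ∧
  ∀ e₁ e₂ : (Fin N → Fin nI) → (Fin N → Fin nO) → ℝ, ∀ α : ℝ,
    IsEffect N nI nO e₁ → IsEffect N nI nO e₂ → 0 < α → α < 1 →
    (∀ P, SNS N nI nO P → ip e P = α * ip e₁ P + (1 - α) * ip e₂ P) →
    (∀ P, SNS N nI nO P → ip e₁ P = ip e P ∧ ip e₂ P = ip e P)

/-- Summing over a set of tuples closed under changing the `i`-th entry, each tuple is hit once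
for every value of its replaced entry. -/
lemma sum_sum_update {ι β : Type*} [DecidableEq ι] [Fintype β] {S : Finset (ι → β)} {i : ι}
    (hS : ∀ a ∈ S, ∀ b, Function.update a i b ∈ S) (f : (ι → β) → ℝ) :
    ∑ a ∈ S, ∑ b, f (Function.update a i b) = Fintype.card β * ∑ a ∈ S, f a := by
  have key : ∑ p ∈ S ×ˢ (Finset.univ : Finset β), f (Function.update p.1 i p.2) =
      ∑ p ∈ S ×ˢ (Finset.univ : Finset β), f p.1 := by
    refine Finset.sum_bij' (fun p _ => (Function.update p.1 i p.2, p.1 i))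
      (fun p _ => (Function.update p.1 i p.2, p.1 i)) ?_ ?_ ?_ ?_ ?_
    · intro p hp
      simpa using hS p.1 (by simpa using hp) p.2
    · intro p hp
      simpa using hS p.1 (by simpa using hp) p.2
    · simp
    · simp
    · simp
  rw [Finset.sum_product, Finset.sum_product] at key
  rw [key, Finset.mul_sum]
  simp

/-- A single party outside `W` cannot influence the marginal of the parties in `W`. -/
lemma NoSig.marginal_eq_of_agree_off {N nI nO : ℕ} (hO : 0 < nO)
    {P : (Fin N → Fin nI) → (Fin N → Fin nO) → ℝ} (hP : NoSig N nI nO P)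
    {W : Finset (Fin N)} {i : Fin N} (hi : i ∉ W) {x x' : Fin N → Fin nI}
    (hx : ∀ j, j ≠ i → x j = x' j) (aW : Fin N → Fin nO) :
    ∑ a ∈ Finset.univ.filter (fun a : Fin N → Fin nO => ∀ i ∈ W, a i = aW i), P x a =
    ∑ a ∈ Finset.univ.filter (fun a : Fin N → Fin nO => ∀ i ∈ W, a i = aW i), P x' a := by
  have hS : ∀ a ∈ Finset.univ.filter (fun a : Fin N → Fin nO => ∀ i ∈ W, a i = aW i),
      ∀ b, Function.update a i b ∈
        Finset.univ.filter (fun a : Fin N → Fin nO => ∀ i ∈ W, a i = aW i) := by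
    intro a ha b
    simp only [Finset.mem_filter, Finset.mem_univ, true_and] at ha ⊢
    intro j hj
    rw [Function.update_of_ne (ne_of_mem_of_not_mem hj hi), ha j hj]
  have hcard : (Fintype.card (Fin nO) : ℝ) ≠ 0 := by
    rw [Fintype.card_fin]
    exact_mod_cast hO.ne'
  refine mul_left_cancel₀ hcard ?_
  rw [← sum_sum_update hS, ← sum_sum_update hS]
  exact Finset.sum_congr rfl fun a _ => hP i x x' hx a

/-- The parties in a set `T` disjoint from `W` cannot influence the marginal of those in `W`. -/
lemma NoSig.marginal_eq_of_disjoint {N nI nO : ℕ} (hO : 0 < nO)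
    {P : (Fin N → Fin nI) → (Fin N → Fin nO) → ℝ} (hP : NoSig N nI nO P)
    {W : Finset (Fin N)} (aW : Fin N → Fin nO) {T : Finset (Fin N)} (hT : ∀ i ∈ T, i ∉ W)
    {x x' : Fin N → Fin nI} (hx : ∀ j, j ∉ T → x j = x' j) :
    ∑ a ∈ Finset.univ.filter (fun a : Fin N → Fin nO => ∀ i ∈ W, a i = aW i), P x a =
    ∑ a ∈ Finset.univ.filter (fun a : Fin N → Fin nO => ∀ i ∈ W, a i = aW i), P x' a := by
  induction T using Finset.induction_on generalizing x with
  | empty => rw [funext fun j => hx j (Finset.notMem_empty j)]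
  | insert i T _ ih =>
    have hstep : ∀ j, j ≠ i → x j = Function.update x i (x' i) j :=
      fun j hj => (Function.update_of_ne hj _ _).symm
    rw [hP.marginal_eq_of_agree_off hO (hT i (Finset.mem_insert_self i T)) hstep aW]
    refine ih (fun j hj => hT j (Finset.mem_insert_of_mem hj)) fun j hj => ?_
    by_cases hji : j = i
    · subst hji
      simp
    · rw [Function.update_of_ne hji]
      exact hx j (by simp [hji, hj])

theorem full_no_signalling_from_single_party (N nI nO : ℕ)
    (hN : 0 < N) (hI : 0 < nI) (hO : 0 < nO)
    (P : (Fin N → Fin nI) → (Fin N → Fin nO) → ℝ) (hP : NoSig N nI nO P) :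
    ∀ W : Finset (Fin N), ∀ x x' : Fin N → Fin nI, (∀ i ∈ W, x i = x' i) →
      ∀ aW : Fin N → Fin nO,
        ∑ a ∈ Finset.univ.filter (fun a : Fin N → Fin nO => ∀ i ∈ W, a i = aW i), P x a =
        ∑ a ∈ Finset.univ.filter (fun a : Fin N → Fin nO => ∀ i ∈ W, a i = aW i), P x' a := by
  intro W x x' hx aW
  refine hP.marginal_eq_of_disjoint hO aW (T := Wᶜ) (fun i hi => Finset.mem_compl.1 hi) ?_
  exact fun j hj => hx j (by simpa using hj)
end

section
/- For every input tuple x₀ ∈ X and output tuple a₀ ∈ A, the standard basis vector e ∈ ℝ^(X × A) (with e(x₀, a₀) = 1 and all other entries 0) is an effect vector, and it is extremal. -/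
open Finset

/-- The local deterministic behaviour in which party `i` answers input `s` with `l i s`. -/
def deterministicBehaviour {N nI nO : ℕ} (l : Fin N → Fin nI → Fin nO) :
    (Fin N → Fin nI) → (Fin N → Fin nO) → ℝ :=
  fun x a => if a = (fun i => l i (x i)) then 1 else 0

/-- Party `i` is fixed to input `s` and output `t` in `P`, and then made to answer
deterministically according to `f`. -/
def replaceParty {N nI nO : ℕ} (P : (Fin N → Fin nI) → (Fin N → Fin nO) → ℝ)
    (i : Fin N) (s : Fin nI) (t : Fin nO) (f : Fin nI → Fin nO) :
    (Fin N → Fin nI) → (Fin N → Fin nO) → ℝ :=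
  fun x a => if a i = f (x i) then P (Function.update x i s) (Function.update a i t) else 0

section

variable {N nI nO : ℕ}

theorem deterministicBehaviour_mem_SNS (l : Fin N → Fin nI → Fin nO) :
    SNS N nI nO (deterministicBehaviour l) := by
  refine ⟨?_, ?_, ?_⟩
  · intro i x x' hx a
    have key : ∀ y : Fin N → Fin nI,
        ∑ b : Fin nO, deterministicBehaviour l y (Function.update a i b) =
          if ∀ j, j ≠ i → a j = l j (y j) then 1 else 0 := by
      intro y
      simp only [deterministicBehaviour, Function.update_eq_iff, ite_and]
      simp
    rw [key, key]
    refine if_congr (forall_congr' fun j => imp_congr_right fun hj => ?_) rfl rfl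
    rw [hx j hj]
  · intro x a
    unfold deterministicBehaviour
    split_ifs <;> norm_num
  · intro x
    simp [deterministicBehaviour]

theorem NoSig.noSig_replaceParty {P : (Fin N → Fin nI) → (Fin N → Fin nO) → ℝ}
    (hP : NoSig N nI nO P) (i : Fin N) (s : Fin nI) (t : Fin nO) (f : Fin nI → Fin nO) :
    NoSig N nI nO (replaceParty P i s t f) := by
  intro j x x' hx a
  unfold replaceParty
  by_cases hj : j = i
  · subst hj
    have hxx : Function.update x j s = Function.update x' j s := by
      ext k
      by_cases hk : k = j
      · subst hk; simp
      · simp [hk, hx k hk]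
    simp [hxx]
  · have hi : x i = x' i := hx i (Ne.symm hj)
    simp only [Function.update_of_ne (Ne.symm hj), hi]
    split_ifs
    · simp only [Function.update_comm hj]
      refine hP j _ _ (fun k hk => ?_) _
      by_cases hki : k = i
      · subst hki; simp
      · simp [hki, hx k hk]
    · rfl

theorem NoSig.eq_sum_replaceParty {P : (Fin N → Fin nI) → (Fin N → Fin nO) → ℝ}
    (hP : NoSig N nI nO P) (i : Fin N) (s₀ : Fin nI) (f : Fin nI → Fin nO) :
    P = ∑ s, ∑ t, (replaceParty P i s t (Function.update f s t) -
          replaceParty P i s t f) + ∑ t, replaceParty P i s₀ t f := by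
  ext x a
  simp only [Pi.add_apply, Finset.sum_apply, Pi.sub_apply]
  rw [Finset.sum_eq_single (x i)]
  · have h := hP i x (Function.update x i s₀)
      (fun j hj => (Function.update_of_ne hj _ _).symm) a
    by_cases ha : a i = f (x i)
    · simp [replaceParty, ha, Finset.sum_sub_distrib, ← h]
      simp [← ha]
    · simp [replaceParty, ha]
  · intro s _ hs
    refine Finset.sum_eq_zero fun t _ => ?_
    simp [replaceParty, Function.update_of_ne hs.symm]
  · simp

theorem eq_of_eq_of_agree_off_single {h : (Fin N → Fin nI) → ℝ}
    (hh : ∀ i x x', (∀ j, j ≠ i → x j = x' j) → h x = h x') (x x' : Fin N → Fin nI) :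
    h x = h x' := by
  suffices H : ∀ S : Finset (Fin N), ∀ x : Fin N → Fin nI, (∀ i, i ∉ S → x i = x' i) →
      h x = h x' from H univ x (by simp)
  intro S
  induction S using Finset.induction_on with
  | empty => exact fun x hx => congrArg h (funext fun i => hx i (by simp))
  | insert i S _ ih =>
    intro x hx
    rw [hh i x (Function.update x i (x' i)) fun j hj => (Function.update_of_ne hj _ _).symm]
    refine ih _ fun j hj => ?_
    by_cases hji : j = i
    · subst hji; simp
    · simp [hji, hx j (by simp [hji, hj])]

theorem NoSig.eq_smul_deterministicBehaviour {P : (Fin N → Fin nI) → (Fin N → Fin nO) → ℝ}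
    (hP : NoSig N nI nO P) (x₀ : Fin N → Fin nI) (l : Fin N → Fin nI → Fin nO)
    (hl : ∀ i x a, a i ≠ l i (x i) → P x a = 0) :
    P = P x₀ (fun i => l i (x₀ i)) • deterministicBehaviour l := by
  have hsum : ∀ (i : Fin N) (x : Fin N → Fin nI) (a : Fin N → Fin nO),
      ∑ b, P x (Function.update a i b) = P x (Function.update a i (l i (x i))) := by
    intro i x a
    refine Finset.sum_eq_single _ (fun b _ hb => hl i _ _ (by simpa using hb)) (by simp)
  have hconst : ∀ x, P x (fun i => l i (x i)) = P x₀ (fun i => l i (x₀ i)) := by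
    intro x
    refine eq_of_eq_of_agree_off_single (h := fun x => P x (fun i => l i (x i)))
      (fun i x x' hx => ?_) x x₀
    have h := hP i x x' hx (fun i => l i (x i))
    rw [hsum, hsum] at h
    convert h using 2
    · simp
    · ext j
      by_cases hj : j = i
      · subst hj; simp
      · simp [hj, hx j hj]
  ext x a
  by_cases ha : a = fun i => l i (x i)
  · subst ha
    simp [deterministicBehaviour, hconst]
  · obtain ⟨i, hi⟩ := Function.ne_iff.mp ha
    simp [deterministicBehaviour, ha, hl i x a hi]

/-- Every no-signalling behaviour is a linear combination of local deterministic ones. -/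
theorem NoSig.mem_span_deterministicBehaviour {P : (Fin N → Fin nI) → (Fin N → Fin nO) → ℝ}
    (hP : NoSig N nI nO P) (x₀ : Fin N → Fin nI) (a₀ : Fin N → Fin nO) :
    P ∈ Submodule.span ℝ (Set.range (deterministicBehaviour (N := N) (nI := nI) (nO := nO))) := by
  suffices H : ∀ S : Finset (Fin N), ∀ (P : (Fin N → Fin nI) → (Fin N → Fin nO) → ℝ)
      (l : Fin N → Fin nI → Fin nO), NoSig N nI nO P →
      (∀ i, i ∉ S → ∀ x a, a i ≠ l i (x i) → P x a = 0) →
      P ∈ Submodule.span ℝ (Set.range (deterministicBehaviour (N := N) (nI := nI) (nO := nO))) from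
    H univ P (fun i _ => a₀ i) hP (by simp)
  intro S
  induction S using Finset.induction_on with
  | empty =>
    intro P l hP hl
    rw [hP.eq_smul_deterministicBehaviour x₀ l fun i => hl i (by simp)]
    exact Submodule.smul_mem _ _ (Submodule.subset_span ⟨l, rfl⟩)
  | insert i S _ ih =>
    intro P l hP hl
    have hmem : ∀ s t f, replaceParty P i s t f ∈ Submodule.span ℝ
        (Set.range (deterministicBehaviour (N := N) (nI := nI) (nO := nO))) := by
      intro s t f
      refine ih _ (Function.update l i f) (hP.noSig_replaceParty i s t f) fun j hj x a hja => ?_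
      unfold replaceParty
      by_cases hji : j = i
      · subst hji
        exact if_neg (by simpa using hja)
      · have h0 := hl j (by simp [hji, hj]) (Function.update x i s) (Function.update a i t)
          (by simpa [hji] using hja)
        simp [h0]
    rw [hP.eq_sum_replaceParty i (x₀ i) (l i)]
    exact add_mem (sum_mem fun s _ => sum_mem fun t _ => sub_mem (hmem _ _ _) (hmem _ _ _))
      (sum_mem fun t _ => hmem _ _ _)

theorem ip_add_right (e P Q : (Fin N → Fin nI) → (Fin N → Fin nO) → ℝ) :
    ip e (P + Q) = ip e P + ip e Q := by
  simp [ip, mul_add, Finset.sum_add_distrib]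

theorem ip_smul_right (e : (Fin N → Fin nI) → (Fin N → Fin nO) → ℝ) (c : ℝ)
    (P : (Fin N → Fin nI) → (Fin N → Fin nO) → ℝ) : ip e (c • P) = c * ip e P := by
  simp [ip, Finset.mul_sum, mul_left_comm]

/-- Effects are determined on no-signalling behaviours by their values at the local deterministic
ones. -/
theorem ip_eq_of_eq_on_deterministicBehaviour
    {e e' P : (Fin N → Fin nI) → (Fin N → Fin nO) → ℝ}
    (h : ∀ l, ip e (deterministicBehaviour l) = ip e' (deterministicBehaviour l))
    (hP : NoSig N nI nO P) (x₀ : Fin N → Fin nI) (a₀ : Fin N → Fin nO) : ip e P = ip e' P := by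
  have hspan := hP.mem_span_deterministicBehaviour x₀ a₀
  clear hP
  induction hspan using Submodule.span_induction with
  | mem Q hQ => obtain ⟨l, rfl⟩ := hQ; exact h l
  | zero => simp [ip]
  | add Q R _ _ hQ hR => rw [ip_add_right, ip_add_right, hQ, hR]
  | smul c Q _ hQ => rw [ip_smul_right, ip_smul_right, hQ]

theorem ip_single (x₀ : Fin N → Fin nI) (a₀ : Fin N → Fin nO)
    (P : (Fin N → Fin nI) → (Fin N → Fin nO) → ℝ) :
    ip (fun x a => if x = x₀ ∧ a = a₀ then (1 : ℝ) else 0) P = P x₀ a₀ := by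
  simp [ip, ite_and]

theorem isEffect_single (x₀ : Fin N → Fin nI) (a₀ : Fin N → Fin nO) :
    IsEffect N nI nO (fun x a => if x = x₀ ∧ a = a₀ then (1 : ℝ) else 0) := by
  rintro P ⟨-, hpos, hsum⟩
  rw [ip_single]
  exact ⟨hpos _ _, hsum x₀ ▸
    Finset.single_le_sum (f := P x₀) (fun a _ => hpos x₀ a) (Finset.mem_univ a₀)⟩

/-- `0` and `1` are extreme points of the unit interval. -/
theorem eq_and_eq_of_convex_combination {u v w α : ℝ} (hw : w = 0 ∨ w = 1)
    (hu : 0 ≤ u ∧ u ≤ 1) (hv : 0 ≤ v ∧ v ≤ 1) (hα : 0 < α) (hα' : α < 1)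
    (h : w = α * u + (1 - α) * v) : u = w ∧ v = w := by
  obtain ⟨hu0, hu1⟩ := hu
  obtain ⟨hv0, hv1⟩ := hv
  have hβ : 0 < 1 - α := sub_pos.mpr hα'
  rcases hw with rfl | rfl
  · constructor <;> nlinarith [mul_nonneg hα.le hu0, mul_nonneg hβ.le hv0]
  · constructor <;> nlinarith [mul_nonneg hα.le (sub_nonneg.mpr hu1),
      mul_nonneg hβ.le (sub_nonneg.mpr hv1)]

end

theorem sbv_is_extremal_effect (N nI nO : ℕ)
    (hN : 0 < N) (hI : 0 < nI) (hO : 0 < nO)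
    (x₀ : Fin N → Fin nI) (a₀ : Fin N → Fin nO) :
    IsEffect N nI nO (fun x a => if x = x₀ ∧ a = a₀ then (1 : ℝ) else 0) ∧
    IsExtremalEffect N nI nO (fun x a => if x = x₀ ∧ a = a₀ then (1 : ℝ) else 0) := by
  refine ⟨isEffect_single x₀ a₀, isEffect_single x₀ a₀, ?_⟩
  intro e₁ e₂ α h₁ h₂ hα hα' h P hP
  have hdet : ∀ l, _ := fun l => eq_and_eq_of_convex_combination
    (by
      rw [ip_single]
      unfold deterministicBehaviour
      split_ifs <;> simp)
    (h₁ _ (deterministicBehaviour_mem_SNS l)) (h₂ _ (deterministicBehaviour_mem_SNS l)) hα hα'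
    (h _ (deterministicBehaviour_mem_SNS l))
  exact ⟨ip_eq_of_eq_on_deterministicBehaviour (fun l => (hdet l).1) hP.1 x₀ a₀,
    ip_eq_of_eq_on_deterministicBehaviour (fun l => (hdet l).2) hP.1 x₀ a₀⟩
end

section
/- Let u ∈ ℝ^(X × A) be a {0,1}-valued vector representing the identity effect, and let e ∈ ℝ^(X × A) be any {0,1}-valued vector with e(x,a) ≤ u(x,a) for every (x,a) (i.e., e is formed from u by replacing any number of the 1 entries with 0s). Then e is an extremal effect vector. -/
open Finset

/-- The local deterministic behaviour in which party `i` answers input `s` with `f i s`. -/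
def localDet {N nI nO : ℕ} (f : Fin N → Fin nI → Fin nO) :
    (Fin N → Fin nI) → (Fin N → Fin nO) → ℝ :=
  fun x a => if a = fun i => f i (x i) then 1 else 0

theorem ip_localDet {N nI nO : ℕ} (v : (Fin N → Fin nI) → (Fin N → Fin nO) → ℝ)
    (f : Fin N → Fin nI → Fin nO) :
    ip v (localDet f) = ∑ x, v x (fun i => f i (x i)) := by
  simp [ip, localDet]

theorem sns_localDet {N nI nO : ℕ} (f : Fin N → Fin nI → Fin nO) :
    SNS N nI nO (localDet f) := by
  refine ⟨fun i x x' hx a => ?_, fun x a => ?_, fun x => ?_⟩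
  · have key : ∀ y : Fin N → Fin nI,
        ∑ b : Fin nO, localDet f y (Function.update a i b) =
          if ∀ j, j ≠ i → a j = f j (y j) then 1 else 0 := by
      intro y
      have hb : ∀ b, localDet f y (Function.update a i b) =
          if b = f i (y i) then (if ∀ j, j ≠ i → a j = f j (y j) then 1 else 0) else 0 := by
        intro b
        rw [← ite_and]
        simp only [localDet, Function.update_eq_iff]
      simp [hb]
    rw [key, key]
    have hiff : (∀ j, j ≠ i → a j = f j (x j)) ↔ ∀ j, j ≠ i → a j = f j (x' j) :=
      forall_congr' fun j => forall_congr' fun hj => by rw [hx j hj]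
    simp only [hiff]
  · unfold localDet
    split_ifs <;> norm_num
  · simp [localDet]

/-- Evaluate party `i` at input `s` and output `b`, and let it answer deterministically by `g`. -/
def determinize {N nI nO : ℕ} (i : Fin N) (g : Fin nI → Fin nO) (s : Fin nI) (b : Fin nO) :
    ((Fin N → Fin nI) → (Fin N → Fin nO) → ℝ) →ₗ[ℝ]
      ((Fin N → Fin nI) → (Fin N → Fin nO) → ℝ) where
  toFun Q x a := if a i = g (x i) then Q (Function.update x i s) (Function.update a i b) else 0
  map_add' Q R := by
    ext x a
    by_cases h : a i = g (x i) <;> simp [h]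
  map_smul' c Q := by
    ext x a
    by_cases h : a i = g (x i) <;> simp [h]

/-- Vectors in which the parties in `S` answer deterministically, independently of the others. -/
def detOn {N nI nO : ℕ} (S : Finset (Fin N)) :
    Set ((Fin N → Fin nI) → (Fin N → Fin nO) → ℝ) :=
  {Q | ∃ (f : Fin N → Fin nI → Fin nO) (R : (Fin N → Fin nI) → (Fin N → Fin nO) → ℝ),
    (∀ x x' a a', (∀ j, j ∉ S → x j = x' j ∧ a j = a' j) → R x a = R x' a') ∧
    ∀ x a, Q x a = if ∀ j ∈ S, a j = f j (x j) then R x a else 0}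

theorem determinize_mem_detOn {N nI nO : ℕ} {S : Finset (Fin N)} {i : Fin N} (hi : i ∉ S)
    (g : Fin nI → Fin nO) (s : Fin nI) (b : Fin nO)
    {Q : (Fin N → Fin nI) → (Fin N → Fin nO) → ℝ} (hQ : Q ∈ detOn S) :
    determinize i g s b Q ∈ detOn (insert i S) := by
  obtain ⟨f, R, hR, hQ⟩ := hQ
  refine ⟨Function.update f i g,
    fun x a => R (Function.update x i s) (Function.update a i b), ?_, ?_⟩
  · intro x x' a a' h
    refine hR _ _ _ _ fun j hj => ?_
    by_cases hji : j = i
    · subst hji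
      simp
    · simpa [hji] using h j (by simp [hji, hj])
  · intro x a
    have h₁ : (∀ j ∈ S, Function.update a i b j = f j (Function.update x i s j)) ↔
        ∀ j ∈ S, a j = Function.update f i g j (x j) :=
      forall_congr' fun j => forall_congr' fun hj => by
        have hji : j ≠ i := fun h => hi (h ▸ hj)
        simp [hji]
    change (if a i = g (x i) then Q _ _ else 0) = _
    simp only [hQ, h₁, forall_mem_insert, Function.update_self, ite_and]

theorem determinize_mem_span {N nI nO : ℕ} {S : Finset (Fin N)} {i : Fin N} (hi : i ∉ S)
    (g : Fin nI → Fin nO) (s : Fin nI) (b : Fin nO)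
    {Q : (Fin N → Fin nI) → (Fin N → Fin nO) → ℝ} (hQ : Q ∈ Submodule.span ℝ (detOn S)) :
    determinize i g s b Q ∈ Submodule.span ℝ (detOn (insert i S)) := by
  have hle : Submodule.span ℝ (detOn S) ≤
      (Submodule.span ℝ (detOn (insert i S))).comap (determinize i g s b) :=
    Submodule.span_le.2 fun Q hQ => Submodule.subset_span (determinize_mem_detOn hi g s b hQ)
  exact hle hQ

theorem NoSig.eq_determinize {N nI nO : ℕ} {P : (Fin N → Fin nI) → (Fin N → Fin nO) → ℝ}
    (hP : NoSig N nI nO P) (i : Fin N) (s₀ : Fin nI) (o : Fin nO) :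
    P = (∑ s, ∑ b, determinize i (fun t => if t = s then b else o) s b P) -
      ((nI : ℝ) - 1) • ∑ b, determinize i (fun _ => o) s₀ b P := by
  ext x a
  set C : ℝ := if a i = o then
    ∑ b, P (Function.update x i s₀) (Function.update a i b) else 0 with hC
  have h₀ : (∑ b, determinize i (fun _ => o) s₀ b P) x a = C := by
    simp only [Finset.sum_apply, determinize, LinearMap.coe_mk, AddHom.coe_mk, hC]
    split_ifs <;> simp
  have h₁ : ∀ s, (∑ b, determinize i (fun t => if t = s then b else o) s b P) x a =
      C + if x i = s then P x a - C else 0 := by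
    intro s
    simp only [Finset.sum_apply, determinize, LinearMap.coe_mk, AddHom.coe_mk]
    by_cases hs : x i = s
    · subst hs
      simp
    · simp only [hs, if_false, add_zero, hC]
      split_ifs
      · exact hP i _ _ (fun j hj => by simp [hj]) a
      · simp
  rw [Pi.sub_apply, Pi.sub_apply, Pi.smul_apply, Pi.smul_apply, h₀,
    Finset.sum_apply, Finset.sum_apply, Finset.sum_congr rfl fun s _ => h₁ s,
    Finset.sum_add_distrib]
  simp
  ring

theorem NoSig.mem_span_detOn {N nI nO : ℕ} {P : (Fin N → Fin nI) → (Fin N → Fin nO) → ℝ}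
    (hP : NoSig N nI nO P) (s₀ : Fin nI) (o : Fin nO) (S : Finset (Fin N)) :
    P ∈ Submodule.span ℝ (detOn S) := by
  induction S using Finset.induction_on with
  | empty =>
    refine Submodule.subset_span ⟨fun _ _ => o, P, fun x x' a a' h => ?_, by simp⟩
    rw [funext fun j => (h j (by simp)).1, funext fun j => (h j (by simp)).2]
  | insert i S hi ih =>
    rw [hP.eq_determinize i s₀ o]
    exact Submodule.sub_mem _
      (Submodule.sum_mem _ fun s _ => Submodule.sum_mem _ fun b _ =>
        determinize_mem_span hi _ s b ih)
      (Submodule.smul_mem _ _ (Submodule.sum_mem _ fun b _ =>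
        determinize_mem_span hi _ s₀ b ih))

/-- The local deterministic behaviours span the space of no-signalling vectors. -/
theorem NoSig.mem_span_localDet {N nI nO : ℕ}
    {P : (Fin N → Fin nI) → (Fin N → Fin nO) → ℝ}
    (hP : NoSig N nI nO P) (s₀ : Fin nI) (o : Fin nO) :
    P ∈ Submodule.span ℝ (Set.range localDet) := by
  have hle : Submodule.span ℝ (detOn Finset.univ) ≤
      Submodule.span ℝ (Set.range (localDet (N := N) (nI := nI) (nO := nO))) := by
    refine Submodule.span_le.2 ?_
    rintro Q ⟨f, R, hR, hQ⟩
    have h : Q = R (fun _ => s₀) (fun _ => o) • localDet f := by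
      ext x a
      rw [hQ, hR x (fun _ => s₀) a (fun _ => o) (by simp)]
      simp [localDet, funext_iff]
    rw [h]
    exact Submodule.smul_mem _ _ (Submodule.subset_span ⟨f, rfl⟩)
  exact hle (hP.mem_span_detOn s₀ o Finset.univ)

/-- Two vectors that agree on the local deterministic behaviours agree on all no-signalling ones. -/
theorem NoSig.ip_congr {N nI nO : ℕ} {P : (Fin N → Fin nI) → (Fin N → Fin nO) → ℝ}
    (hP : NoSig N nI nO P) (s₀ : Fin nI) (o : Fin nO)
    {v w : (Fin N → Fin nI) → (Fin N → Fin nO) → ℝ}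
    (h : ∀ f, ip v (localDet f) = ip w (localDet f)) : ip v P = ip w P := by
  have hmem := hP.mem_span_localDet s₀ o
  clear hP
  induction hmem using Submodule.span_induction with
  | mem Q hQ =>
    obtain ⟨f, rfl⟩ := hQ
    exact h f
  | zero => simp [ip]
  | add Q R _ _ hQ hR =>
    simp only [ip, Pi.add_apply, mul_add, Finset.sum_add_distrib] at hQ hR ⊢
    rw [hQ, hR]
  | smul c Q _ hQ =>
    simp only [ip, Pi.smul_apply, smul_eq_mul, mul_left_comm _ c, ← Finset.mul_sum] at hQ ⊢
    rw [hQ]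

theorem subeffect_of_01_identity_is_extremal (N nI nO : ℕ)
    (hN : 0 < N) (hI : 0 < nI) (hO : 0 < nO)
    (u e : (Fin N → Fin nI) → (Fin N → Fin nO) → ℝ)
    (hu01 : ∀ x a, u x a = 0 ∨ u x a = 1)
    (huid : ∀ P, SNS N nI nO P → ip u P = 1)
    (he01 : ∀ x a, e x a = 0 ∨ e x a = 1)
    (hle : ∀ x a, e x a ≤ u x a) :
    IsEffect N nI nO e ∧ IsExtremalEffect N nI nO e := by
  have he0 : ∀ x a, 0 ≤ e x a := fun x a => by
    rcases he01 x a with h | h <;> rw [h]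
    exact zero_le_one
  have heff : IsEffect N nI nO e := fun P hP =>
    ⟨Finset.sum_nonneg fun x _ => Finset.sum_nonneg fun a _ => mul_nonneg (he0 x a) (hP.2.1 x a),
      (Finset.sum_le_sum fun x _ => Finset.sum_le_sum fun a _ =>
        mul_le_mul_of_nonneg_right (hle x a) (hP.2.1 x a)).trans_eq (huid P hP)⟩
  refine ⟨heff, heff, fun e₁ e₂ α h₁ h₂ hα₀ hα₁ hconv P hP => ?_⟩
  have hdet : ∀ f, ip e₁ (localDet f) = ip e (localDet f) ∧
      ip e₂ (localDet f) = ip e (localDet f) := by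
    intro f
    have hD := sns_localDet (N := N) f
    have h01 : ip e (localDet f) = 0 ∨ ip e (localDet f) = 1 := by
      by_cases hz : ∀ x, e x (fun i => f i (x i)) = 0
      · left
        simp [ip_localDet, hz]
      · right
        push Not at hz
        obtain ⟨x, hx⟩ := hz
        refine le_antisymm (heff _ hD).2 ?_
        rw [ip_localDet, ← (he01 x _).resolve_left hx]
        exact Finset.single_le_sum (f := fun x => e x (fun i => f i (x i)))
          (fun y _ => he0 y _) (Finset.mem_univ x)
    have hc := hconv _ hD
    obtain ⟨h₁0, h₁1⟩ := h₁ _ hD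
    obtain ⟨h₂0, h₂1⟩ := h₂ _ hD
    rcases h01 with h | h <;> rw [h] at hc ⊢ <;> constructor <;> nlinarith
  exact ⟨hP.1.ip_congr ⟨0, hI⟩ ⟨0, hO⟩ fun f => (hdet f).1,
    hP.1.ip_congr ⟨0, hI⟩ ⟨0, hO⟩ fun f => (hdet f).2⟩
end

section
/- Let e be an extremal effect vector that is a wiring. Then there exist {0,1}-valued vectors e', u' ∈ ℝ^(X × A) such that u' represents the identity effect, e'(x,a) ≤ u'(x,a) for every (x,a) (i.e., e' is formed from u' by replacing some of the 1 entries with 0s), and ⟨e', P⟩ = ⟨e, P⟩ for every P ∈ S_NS. -/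
open Finset

/-- Deterministic wiring vectors, defined recursively on the number of parties. -/
inductive IsDetWiring (nI nO : ℕ) : (N : ℕ) → ((Fin N → Fin nI) → (Fin N → Fin nO) → ℝ) → Prop
  | base (xhat : Fin nI) (T : Finset (Fin nO)) :
      IsDetWiring nI nO 1 (fun x a => if x 0 = xhat ∧ a 0 ∈ T then 1 else 0)
  | step (m : ℕ) (hm : 1 ≤ m) (k : Fin (m + 1)) (xhat : Fin nI)
      (w : Fin nO → (Fin m → Fin nI) → (Fin m → Fin nO) → ℝ)
      (hw : ∀ b, IsDetWiring nI nO m (w b)) :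
      IsDetWiring nI nO (m + 1)
        (fun x a => if x k = xhat then
          w (a k) (fun j => x (k.succAbove j)) (fun j => a (k.succAbove j)) else 0)

/-- An effect vector is a wiring if its functional on the state space is a convex
combination of functionals of deterministic wiring vectors. -/
def IsWiring (N nI nO : ℕ) (e : (Fin N → Fin nI) → (Fin N → Fin nO) → ℝ) : Prop :=
  ∃ (n : ℕ) (w : Fin n → (Fin N → Fin nI) → (Fin N → Fin nO) → ℝ) (lam : Fin n → ℝ),
    (∀ i, IsDetWiring nI nO N (w i)) ∧ (∀ i, 0 ≤ lam i) ∧ (∑ i, lam i) = 1 ∧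
    ∀ P, SNS N nI nO P → ip e P = ∑ i, lam i * ip (w i) P

theorem Fintype.sum_insertNth {M α : Type*} [AddCommMonoid M] [Fintype α] {m : ℕ}
    (k : Fin (m + 1)) (f : (Fin (m + 1) → α) → M) :
    ∑ a, f a = ∑ b : α, ∑ a' : Fin m → α, f (k.insertNth b a') := by
  rw [← (Fin.insertNthEquiv (fun _ => α) k).sum_comp f, Fintype.sum_prod_type]
  rfl

/-- The total mass of a no-signalling vector does not depend on the input of a single party. -/
theorem NoSig.sum_eq {m nI nO : ℕ} {P : (Fin (m + 1) → Fin nI) → (Fin (m + 1) → Fin nO) → ℝ}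
    (hP : NoSig (m + 1) nI nO P) (k : Fin (m + 1)) {x x' : Fin (m + 1) → Fin nI}
    (h : ∀ j, j ≠ k → x j = x' j) : ∑ a, P x a = ∑ a, P x' a := by
  rcases isEmpty_or_nonempty (Fin nO) with _ | ⟨⟨b₀⟩⟩
  · simp
  rw [Fintype.sum_insertNth k, Fintype.sum_insertNth k, sum_comm]
  conv_rhs => rw [sum_comm]
  refine sum_congr rfl fun a' _ => ?_
  simpa [Fin.update_insertNth] using hP k x x' h (k.insertNth b₀ a')

/-- Fixing the input and the output of one party preserves the no-signalling conditions. -/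
theorem NoSig.insertNth {m nI nO : ℕ}
    {P : (Fin (m + 1) → Fin nI) → (Fin (m + 1) → Fin nO) → ℝ}
    (hP : NoSig (m + 1) nI nO P) (k : Fin (m + 1)) (xhat : Fin nI) (b : Fin nO) :
    NoSig m nI nO fun x a => P (k.insertNth xhat x) (k.insertNth b a) := by
  intro i x x' h a
  have key := hP (k.succAbove i) (k.insertNth xhat x) (k.insertNth xhat x')
    (fun j hj => by
      induction j using Fin.succAboveCases k with
      | x => simp
      | p j => simpa using h j fun hji => hj (congrArg _ hji))
    (k.insertNth b a)
  simpa only [Fin.insertNth_update] using key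

theorem ip_step {m nI nO : ℕ} (k : Fin (m + 1)) (xhat : Fin nI)
    (u : Fin nO → (Fin m → Fin nI) → (Fin m → Fin nO) → ℝ)
    (P : (Fin (m + 1) → Fin nI) → (Fin (m + 1) → Fin nO) → ℝ) :
    ip (fun x a => if x k = xhat then
        u (a k) (fun j => x (k.succAbove j)) (fun j => a (k.succAbove j)) else 0) P =
      ∑ b, ip (u b) fun x a => P (k.insertNth xhat x) (k.insertNth b a) := by
  unfold ip
  rw [Fintype.sum_insertNth k, Fintype.sum_eq_single xhat (fun y hy => by simp [hy])]
  conv_rhs => rw [sum_comm]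
  refine sum_congr rfl fun x _ => ?_
  rw [Fintype.sum_insertNth k]
  simp

/-- A deterministic wiring vector is `{0,1}`-valued and dominated by a `{0,1}`-valued vector that
returns the total mass of every no-signalling vector. -/
theorem IsDetWiring.exists_identity {N nI nO : ℕ}
    {w : (Fin N → Fin nI) → (Fin N → Fin nO) → ℝ} (hw : IsDetWiring nI nO N w) :
    (∀ x a, w x a = 0 ∨ w x a = 1) ∧
      ∃ u : (Fin N → Fin nI) → (Fin N → Fin nO) → ℝ,
        (∀ x a, u x a = 0 ∨ u x a = 1) ∧ (∀ x a, w x a ≤ u x a) ∧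
        ∀ P, NoSig N nI nO P → ∀ x₀, ip u P = ∑ a, P x₀ a := by
  induction hw with
  | base xhat T =>
    refine ⟨fun x a => (ite_eq_or_eq _ _ _).symm, fun x _ => if x 0 = xhat then 1 else 0,
      fun x a => (ite_eq_or_eq _ _ _).symm, fun x a => ?_, fun P hP x₀ => ?_⟩
    · dsimp only
      split_ifs <;> simp_all
    · unfold ip
      rw [Fintype.sum_eq_single (fun _ => xhat) fun x hx => ?_]
      · simpa using hP.sum_eq (m := 0) 0 fun j hj => absurd (Fin.eq_zero j) hj
      · have : x 0 ≠ xhat := fun h => hx (funext fun j => by rw [Subsingleton.elim j 0, h])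
        simp [this]
  | step m hm k xhat w hw ih =>
    choose h01 u hu hle hid using ih
    refine ⟨fun x a => ?_, fun x a => if x k = xhat then
        u (a k) (fun j => x (k.succAbove j)) (fun j => a (k.succAbove j)) else 0,
      fun x a => ?_, fun x a => ?_, fun P hP x₀ => ?_⟩
    · dsimp only
      split_ifs
      exacts [h01 _ _ _, Or.inl rfl]
    · dsimp only
      split_ifs
      exacts [hu _ _ _, Or.inl rfl]
    · dsimp only
      split_ifs
      exacts [hle _ _ _, le_rfl]
    · rw [ip_step, hP.sum_eq k (x' := k.insertNth xhat fun j => x₀ (k.succAbove j)) ?_,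
        Fintype.sum_insertNth k]
      · exact sum_congr rfl fun b _ => hid b _ (hP.insertNth k xhat b) _
      · intro j hj
        obtain ⟨i, rfl⟩ := Fin.exists_succAbove_eq hj
        simp

theorem ip_mono {N nI nO : ℕ} {e f P : (Fin N → Fin nI) → (Fin N → Fin nO) → ℝ}
    (h : ∀ x a, e x a ≤ f x a) (hP : ∀ x a, 0 ≤ P x a) : ip e P ≤ ip f P :=
  sum_le_sum fun x _ => sum_le_sum fun a _ => mul_le_mul_of_nonneg_right (h x a) (hP x a)

theorem IsDetWiring.isEffect {N nI nO : ℕ} (hI : 0 < nI)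
    {w : (Fin N → Fin nI) → (Fin N → Fin nO) → ℝ} (hw : IsDetWiring nI nO N w) :
    IsEffect N nI nO w := by
  obtain ⟨h01, u, -, hle, hid⟩ := hw.exists_identity
  rintro P ⟨hns, hpos, hnorm⟩
  constructor
  · refine sum_nonneg fun x _ => sum_nonneg fun a _ => mul_nonneg ?_ (hpos x a)
    rcases h01 x a with h | h <;> simp [h]
  · rw [← hnorm fun _ => ⟨0, hI⟩, ← hid P hns]
    exact ip_mono hle hpos

theorem ip_sub_smul_div {N nI nO : ℕ} (e w P : (Fin N → Fin nI) → (Fin N → Fin nO) → ℝ)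
    (l c : ℝ) : ip (fun x a => (e x a - l * w x a) / c) P = (ip e P - l * ip w P) / c := by
  simp only [ip, mul_sum, ← sum_sub_distrib, sum_div]
  refine sum_congr rfl fun x _ => sum_congr rfl fun a _ => ?_
  ring

/-- An extremal effect that is a wiring acts on states as a single deterministic wiring. -/
theorem IsExtremalEffect.exists_isDetWiring {N nI nO : ℕ} (hI : 0 < nI)
    {e : (Fin N → Fin nI) → (Fin N → Fin nO) → ℝ}
    (he : IsExtremalEffect N nI nO e) (hw : IsWiring N nI nO e) :
    ∃ w, IsDetWiring nI nO N w ∧ ∀ P, SNS N nI nO P → ip w P = ip e P := by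
  obtain ⟨n, w, lam, hdet, hnonneg, hsum, hip⟩ := hw
  obtain ⟨i, -, hi⟩ : ∃ i ∈ univ, 0 < lam i :=
    exists_lt_of_sum_lt (f := fun _ => (0 : ℝ)) (by simp [hsum])
  have hbound : ∀ P, SNS N nI nO P →
      0 ≤ ip e P - lam i * ip (w i) P ∧ ip e P - lam i * ip (w i) P ≤ 1 - lam i := by
    intro P hP
    have hrest : ip e P - lam i * ip (w i) P = ∑ j ∈ univ.erase i, lam j * ip (w j) P := by
      rw [hip P hP, ← add_sum_erase univ (fun j => lam j * ip (w j) P) (mem_univ i)]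
      ring
    have hone : 1 - lam i = ∑ j ∈ univ.erase i, lam j := by
      rw [← hsum, ← add_sum_erase univ lam (mem_univ i)]
      ring
    have heff j := (hdet j).isEffect hI P hP
    rw [hrest, hone]
    exact ⟨sum_nonneg fun j _ => mul_nonneg (hnonneg j) (heff j).1,
      sum_le_sum fun j _ => mul_le_of_le_one_right (hnonneg j) (heff j).2⟩
  refine ⟨w i, hdet i, fun P hP => ?_⟩
  have hle : lam i ≤ 1 := by linarith [hbound P hP]
  rcases hle.eq_or_lt with h1 | h1
  · have := hbound P hP
    rw [h1] at this
    linarith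
  · have hc : 0 < 1 - lam i := by linarith
    refine (he.2 (w i) (fun x a => (e x a - lam i * w i x a) / (1 - lam i)) (lam i)
      ((hdet i).isEffect hI) (fun Q hQ => ?_) hi h1 (fun Q _ => ?_) P hP).1
    · rw [ip_sub_smul_div]
      exact ⟨div_nonneg (hbound Q hQ).1 hc.le, (div_le_one hc).2 (hbound Q hQ).2⟩
    · rw [ip_sub_smul_div]
      field_simp
      ring

theorem extremal_wiring_has_01_subidentity_representation (N nI nO : ℕ)
    (hN : 0 < N) (hI : 0 < nI) (hO : 0 < nO)
    (e : (Fin N → Fin nI) → (Fin N → Fin nO) → ℝ)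
    (he : IsExtremalEffect N nI nO e) (hw : IsWiring N nI nO e) :
    ∃ e' u' : (Fin N → Fin nI) → (Fin N → Fin nO) → ℝ,
      (∀ x a, u' x a = 0 ∨ u' x a = 1) ∧
      (∀ x a, e' x a = 0 ∨ e' x a = 1) ∧
      (∀ P, SNS N nI nO P → ip u' P = 1) ∧
      (∀ x a, e' x a ≤ u' x a) ∧
      (∀ P, SNS N nI nO P → ip e' P = ip e P) := by
  obtain ⟨w, hdet, hwe⟩ := he.exists_isDetWiring hI hw
  obtain ⟨h01, u, hu, hle, hid⟩ := hdet.exists_identity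
  exact ⟨w, u, hu, h01, fun P hP => (hid P hP.1 fun _ => ⟨0, hI⟩).trans (hP.2.2 _), hle, hwe⟩
end

section
/- Two vectors e₁, e₂ ∈ ℝ^(X × A) satisfy ⟨e₁, P⟩ = ⟨e₂, P⟩ for every P ∈ S_NS (i.e., they represent the same effect) if and only if ⟨e₁, P⟩ = ⟨e₂, P⟩ for every local deterministic state P. -/
open Finset

/-- Local deterministic states. -/
def IsLocalDet (N nI nO : ℕ) (P : (Fin N → Fin nI) → (Fin N → Fin nO) → ℝ) : Prop :=
  ∃ f : Fin N → Fin nI → Fin nO,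
    P = fun x a => ∏ i : Fin N, if a i = f i (x i) then (1 : ℝ) else 0

theorem isLocalDet_SNS {N nI nO : ℕ} {P : (Fin N → Fin nI) → (Fin N → Fin nO) → ℝ}
    (hP : IsLocalDet N nI nO P) : SNS N nI nO P := by
  obtain ⟨f, rfl⟩ := hP
  refine ⟨?_, fun x a => prod_nonneg fun i _ => by split_ifs <;> norm_num, fun x => ?_⟩
  · intro i x x' hx a
    have key : ∀ z : Fin N → Fin nI,
        ∑ b : Fin nO, ∏ j, (if Function.update a i b j = f j (z j) then (1 : ℝ) else 0) =
          ∏ j ∈ univ.erase i, (if a j = f j (z j) then (1 : ℝ) else 0) := by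
      intro z
      have h : ∀ b : Fin nO,
          ∏ j, (if Function.update a i b j = f j (z j) then (1 : ℝ) else 0) =
            (if b = f i (z i) then (1 : ℝ) else 0) *
              ∏ j ∈ univ.erase i, (if a j = f j (z j) then (1 : ℝ) else 0) := by
        intro b
        rw [← mul_prod_erase univ _ (mem_univ i), Function.update_self]
        congr 1
        refine prod_congr rfl fun j hj => ?_
        rw [Function.update_of_ne (ne_of_mem_erase hj)]
      simp only [h, ← sum_mul]
      simp
    simp only [key]
    refine prod_congr rfl fun j hj => ?_
    rw [hx j (ne_of_mem_erase hj)]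
  · have := (Finset.prod_univ_sum (fun _ : Fin N => (univ : Finset (Fin nO)))
      (fun i b => if b = f i (x i) then (1 : ℝ) else 0)).symm
    simpa using this

/-- Sums over tuples can be computed by summing over one coordinate first. -/
theorem exists_sum_eq_sum_sum_update {N : ℕ} {β : Type} [Fintype β] [DecidableEq β]
    (i : Fin N) (c : β) : ∃ g : ({j : Fin N // j ≠ i} → β) → Fin N → β,
      ∀ H : (Fin N → β) → ℝ, ∑ v, H v = ∑ r, ∑ b, H (Function.update (g r) i b) := by
  refine ⟨fun r => (Equiv.funSplitAt i β).symm (c, r), fun H => ?_⟩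
  rw [← (Equiv.funSplitAt i β).symm.sum_comp, Fintype.sum_prod_type, sum_comm]
  refine sum_congr rfl fun r _ => sum_congr rfl fun b _ => congrArg H ?_
  funext j
  by_cases h : j = i
  · subst h; simp [Equiv.funSplitAt]
  · simp [Equiv.funSplitAt, h]

/-- The marginal of a no-signalling behaviour on the parties other than `i` is independent of the
input of `i`, so weights of total mass zero on that input annihilate it. -/
theorem NoSig.sum_weight_eq_zero {N nI nO : ℕ}
    {P : (Fin N → Fin nI) → (Fin N → Fin nO) → ℝ} (hP : NoSig N nI nO P)
    (x₀ : Fin nI) (a₀ : Fin nO) (i : Fin N) (w : Fin nI → ℝ) (hw : ∑ y, w y = 0)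
    (F : (Fin N → Fin nI) → (Fin N → Fin nO) → ℝ)
    (hF : ∀ x a y b, F (Function.update x i y) (Function.update a i b) = F x a) :
    ∑ x, ∑ a, P x a * (w (x i) * F x a) = 0 := by
  obtain ⟨gX, hX⟩ := exists_sum_eq_sum_sum_update i x₀
  obtain ⟨gA, hA⟩ := exists_sum_eq_sum_sum_update i a₀
  have hG : ∀ x y, ∑ a, P (Function.update x i y) a * F (Function.update x i y) a =
      ∑ a, P x a * F x a := by
    intro x y
    rw [hA, hA]
    refine sum_congr rfl fun r _ => ?_
    have h : ∀ b, F x (Function.update (gA r) i b) = F x (gA r) := fun b => by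
      simpa using hF x (gA r) (x i) b
    simp only [hF, h, ← sum_mul]
    rw [hP i (Function.update x i y) x (fun j hj => Function.update_of_ne hj _ _)]
  have h : ∀ x, ∑ a, P x a * (w (x i) * F x a) = w (x i) * ∑ a, P x a * F x a := by
    intro x
    rw [mul_sum]
    exact sum_congr rfl fun a _ => by ring
  simp only [h]
  rw [hX]
  simp only [hG, Function.update_self, ← sum_mul, hw, zero_mul, sum_const_zero]

/-- A single-party kernel which is a combination of deterministic responses in `(x, a)` and
reproduces single-party no-signalling behaviours. -/
def localKernel {nI nO : ℕ} (x₀ : Fin nI) (a₀ : Fin nO) (x' : Fin nI) (a' : Fin nO)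
    (x : Fin nI) (a : Fin nO) : ℝ :=
  (if a = Function.update (fun _ => a₀) x' a' x then 1 else 0) +
    ((if x' = x₀ then 1 else 0) - 1) * (if a = a₀ then 1 else 0)

theorem localKernel_eq {nI nO : ℕ} (x₀ : Fin nI) (a₀ : Fin nO) (x' : Fin nI) (a' : Fin nO)
    (x : Fin nI) (a : Fin nO) :
    localKernel x₀ a₀ x' a' x a = (if x' = x ∧ a' = a then 1 else 0) +
      ((if x' = x₀ then 1 else 0) - (if x' = x then 1 else 0)) * (if a = a₀ then 1 else 0) := by
  unfold localKernel
  by_cases h : x' = x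
  · subst h
    simp [eq_comm]
  · have h' : x ≠ x' := fun e => h e.symm
    simp only [Function.update_of_ne h', h, false_and, if_false]
    ring

theorem localKernel_eq_sum {nI nO : ℕ} (x₀ : Fin nI) (a₀ : Fin nO) (x' : Fin nI) (a' : Fin nO) :
    ∃ c : (Fin nI → Fin nO) → ℝ, ∀ x a,
      localKernel x₀ a₀ x' a' x a = ∑ g, c g * (if a = g x then 1 else 0) := by
  refine ⟨fun g => (if g = Function.update (fun _ => a₀) x' a' then 1 else 0) +
    ((if x' = x₀ then 1 else 0) - 1) * (if g = fun _ => a₀ then 1 else 0), fun x a => ?_⟩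
  simp only [add_mul, sum_add_distrib, mul_assoc, ← mul_sum, ite_mul, one_mul, zero_mul,
    sum_ite_eq', mem_univ, if_true, localKernel]

/-- The product kernel reproduces no-signalling behaviours. -/
theorem NoSig.sum_mul_prod_localKernel {N nI nO : ℕ}
    {P : (Fin N → Fin nI) → (Fin N → Fin nO) → ℝ} (hP : NoSig N nI nO P)
    (x₀ : Fin nI) (a₀ : Fin nO) (x : Fin N → Fin nI) (a : Fin N → Fin nO) :
    ∑ x', ∑ a', P x' a' * ∏ i, localKernel x₀ a₀ (x' i) (a' i) (x i) (a i) = P x a := by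
  suffices h : ∀ s : Finset (Fin N), ∑ x', ∑ a', P x' a' *
      ∏ i, (if i ∈ s then localKernel x₀ a₀ (x' i) (a' i) (x i) (a i)
        else if x' i = x i ∧ a' i = a i then 1 else 0) = P x a by
    simpa using h univ
  intro s
  induction s using Finset.induction_on with
  | empty =>
    have h : ∀ (x' : Fin N → Fin nI) (a' : Fin N → Fin nO),
        (∏ i, if x' i = x i ∧ a' i = a i then (1 : ℝ) else 0) =
          if x' = x then (if a' = a then 1 else 0) else 0 := by
      intro x' a'
      rw [Fintype.prod_boole]
      simp only [forall_and, ← funext_iff, ite_and]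
    simp [h]
  | insert i s hi ih =>
    rw [← ih, ← sub_eq_zero, ← sum_sub_distrib]
    simp only [← sum_sub_distrib, ← mul_sub]
    have h := hP.sum_weight_eq_zero x₀ a₀ i
      (fun y => ((if y = x₀ then 1 else 0) - (if y = x i then 1 else 0)) *
        (if a i = a₀ then 1 else 0))
      (by simp)
      (fun x' a' => ∏ j ∈ univ.erase i,
        if j ∈ s then localKernel x₀ a₀ (x' j) (a' j) (x j) (a j)
        else if x' j = x j ∧ a' j = a j then 1 else 0)
      (fun x' a' y b => prod_congr rfl fun j hj => by
        simp only [Function.update_of_ne (ne_of_mem_erase hj)])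
    refine Eq.trans ?_ h
    refine sum_congr rfl fun x' _ => sum_congr rfl fun a' _ => ?_
    congr 1
    rw [← mul_prod_erase univ _ (mem_univ i), ← mul_prod_erase univ _ (mem_univ i),
      if_pos (mem_insert_self i s), if_neg hi, localKernel_eq]
    have hc : (∏ j ∈ univ.erase i,
        if j ∈ insert i s then localKernel x₀ a₀ (x' j) (a' j) (x j) (a j)
        else if x' j = x j ∧ a' j = a j then 1 else 0) = ∏ j ∈ univ.erase i,
        if j ∈ s then localKernel x₀ a₀ (x' j) (a' j) (x j) (a j)
        else if x' j = x j ∧ a' j = a j then 1 else 0 :=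
      prod_congr rfl fun j hj => by simp only [mem_insert, ne_of_mem_erase hj, false_or]
    rw [hc]
    ring

theorem ip_sum_mul {N nI nO : ℕ} {ι : Type*} (s : Finset ι) (c : ι → ℝ)
    (e : (Fin N → Fin nI) → (Fin N → Fin nO) → ℝ)
    (Q : ι → (Fin N → Fin nI) → (Fin N → Fin nO) → ℝ) :
    ip e (fun x a => ∑ k ∈ s, c k * Q k x a) = ∑ k ∈ s, c k * ip e (Q k) := by
  simp only [ip, mul_sum]
  rw [sum_comm (s := s)]
  refine sum_congr rfl fun x _ => ?_
  rw [sum_comm]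
  exact sum_congr rfl fun a _ => sum_congr rfl fun k _ => by ring

/-- Every no-signalling behaviour is a linear combination of local deterministic states. -/
theorem NoSig.exists_eq_sum_localDet {N nI nO : ℕ}
    {P : (Fin N → Fin nI) → (Fin N → Fin nO) → ℝ} (hP : NoSig N nI nO P)
    (x₀ : Fin nI) (a₀ : Fin nO) :
    ∃ c : (Fin N → Fin nI → Fin nO) → ℝ,
      P = fun x a => ∑ f, c f * ∏ i, if a i = f i (x i) then (1 : ℝ) else 0 := by
  choose c hc using fun x' a' => localKernel_eq_sum (nI := nI) (nO := nO) x₀ a₀ x' a'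
  refine ⟨fun f => ∑ x', ∑ a', P x' a' * ∏ i, c (x' i) (a' i) (f i), ?_⟩
  funext x a
  rw [← hP.sum_mul_prod_localKernel x₀ a₀ x a]
  simp only [hc, prod_univ_sum, Fintype.piFinset_univ, prod_mul_distrib, mul_sum, sum_mul]
  rw [sum_comm (s := (univ : Finset (Fin N → Fin nI → Fin nO)))]
  refine sum_congr rfl fun x' _ => ?_
  rw [sum_comm]
  exact sum_congr rfl fun f _ => sum_congr rfl fun a' _ => by ring

theorem same_effect_iff_same_on_localDet (N nI nO : ℕ)
    (hN : 0 < N) (hI : 0 < nI) (hO : 0 < nO)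
    (e₁ e₂ : (Fin N → Fin nI) → (Fin N → Fin nO) → ℝ) :
    (∀ P, SNS N nI nO P → ip e₁ P = ip e₂ P) ↔
    (∀ P, IsLocalDet N nI nO P → ip e₁ P = ip e₂ P) := by
  refine ⟨fun h P hP => h P (isLocalDet_SNS hP), fun h P hP => ?_⟩
  obtain ⟨c, rfl⟩ := hP.1.exists_eq_sum_localDet ⟨0, hI⟩ ⟨0, hO⟩
  rw [ip_sum_mul univ c e₁ fun f x a => ∏ i, if a i = f i (x i) then (1 : ℝ) else 0,
    ip_sum_mul univ c e₂ fun f x a => ∏ i, if a i = f i (x i) then (1 : ℝ) else 0]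
  exact sum_congr rfl fun f _ => by rw [h _ ⟨f, rfl⟩]
end

section
/- Let N ≥ 2 and let e be an effect vector on N parties such that e(x, a) = 0 whenever the first party's input x₁ ≠ 0. For each outcome b ∈ Fin nO, define the vector e_b on N − 1 parties by e_b(x', a') = e(0 ⌢ x', b ⌢ a') (prepending input 0 and output b for the first party). Then each e_b is an effect vector on N − 1 parties. -/
open Finset

/-- Summing over a nonempty tuple is summing over its head and its tail. -/
theorem sum_tuple_eq_sum_cons {m k : ℕ} (g : (Fin (m + 1) → Fin k) → ℝ) :
    ∑ f, g f = ∑ c : Fin k, ∑ f' : Fin m → Fin k, g (Fin.cons c f') := by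
  rw [← (Fin.consEquiv fun _ : Fin (m + 1) => Fin k).sum_comp, Fintype.sum_prod_type]
  rfl

/-- The behaviour in which an extra first party deterministically outputs `b`,
independently of the remaining parties, who share `P`. -/
def prependDet {m nI nO : ℕ} (b : Fin nO) (P : (Fin m → Fin nI) → (Fin m → Fin nO) → ℝ) :
    (Fin (m + 1) → Fin nI) → (Fin (m + 1) → Fin nO) → ℝ :=
  fun x a => if a 0 = b then P (Fin.tail x) (Fin.tail a) else 0

theorem SNS.prepend {m nI nO : ℕ} {P : (Fin m → Fin nI) → (Fin m → Fin nO) → ℝ}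
    (hP : SNS m nI nO P) (b : Fin nO) : SNS (m + 1) nI nO (prependDet b P) := by
  obtain ⟨hns, hpos, hsum⟩ := hP
  refine ⟨fun i => ?_, fun x a => ?_, fun x => ?_⟩
  · refine Fin.cases (fun x x' h a => ?_) (fun j x x' h a => ?_) i
    · have htail : Fin.tail x = Fin.tail x' := funext fun j => h j.succ (Fin.succ_ne_zero j)
      simp only [prependDet, htail]
    · have hsig := hns j (Fin.tail x) (Fin.tail x')
        (fun l hl => h l.succ (by simpa using hl)) (Fin.tail a)
      by_cases ha : a 0 = b
      · simpa [prependDet, Fin.tail_update_succ, Function.update_of_ne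
          (Fin.succ_ne_zero j).symm, ha] using hsig
      · simp [prependDet, Function.update_of_ne (Fin.succ_ne_zero j).symm, ha]
  · unfold prependDet
    split_ifs
    · exact hpos _ _
    · exact le_rfl
  · rw [sum_tuple_eq_sum_cons, Finset.sum_eq_single b]
    · simpa [prependDet] using hsum (Fin.tail x)
    · intro c _ hc
      simp [prependDet, hc]
    · simp

theorem ip_prependDet {m nI nO : ℕ} (e : (Fin (m + 1) → Fin nI) → (Fin (m + 1) → Fin nO) → ℝ)
    (z : Fin nI) (hz : ∀ x a, x 0 ≠ z → e x a = 0) (b : Fin nO)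
    (P : (Fin m → Fin nI) → (Fin m → Fin nO) → ℝ) :
    ip e (prependDet b P) = ip (fun x' a' => e (Fin.cons z x') (Fin.cons b a')) P := by
  unfold ip
  rw [sum_tuple_eq_sum_cons, Finset.sum_eq_single z]
  · refine Finset.sum_congr rfl fun x' _ => ?_
    rw [sum_tuple_eq_sum_cons, Finset.sum_eq_single b]
    · simp [prependDet]
    · intro c _ hc
      simp [prependDet, hc]
    · simp
  · intro c _ hc
    simp [hz _ _ (show (Fin.cons c _ : Fin (m + 1) → Fin nI) 0 ≠ z from hc)]
  · simp

theorem conditional_subeffects_are_effects (nI nO m : ℕ)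
    (hI : 0 < nI) (hO : 0 < nO) (hm : 1 ≤ m)
    (e : (Fin (m + 1) → Fin nI) → (Fin (m + 1) → Fin nO) → ℝ)
    (he : IsEffect (m + 1) nI nO e)
    (hzero : ∀ x a, x 0 ≠ ⟨0, hI⟩ → e x a = 0) :
    ∀ b : Fin nO,
      IsEffect m nI nO
        (fun x' a' => e (Fin.cons ⟨0, hI⟩ x') (Fin.cons b a')) := by
  intro b P hP
  rw [← ip_prependDet e ⟨0, hI⟩ hzero b P]
  exact he _ (hP.prepend b)
end

section
/- In the tripartite setting N = 3, nI = 2, nO = 2: (i) each of the eight product states s₁, …, s₈ lies in S_NS; (ii) each e_i is an effect vector and the sum e₁ + … + e₈ represents the identity effect, i.e., ⟨e₁ + … + e₈, P⟩ = 1 for every P ∈ S_NS, so that {e₁, …, e₈} forms an 8-outcome measurement; and (iii) ⟨e_i, s_j⟩ = 1 if i = j and ⟨e_i, s_j⟩ = 0 if i ≠ j, so the measurement perfectly distinguishes the eight product states. -/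
open Finset

/-- The single-party deterministic behaviour always outputting 0. -/
def t1 : Fin 2 → Fin 2 → ℝ := fun _ a => if a = 0 then 1 else 0
/-- The single-party deterministic behaviour outputting `a = x`. -/
def t2 : Fin 2 → Fin 2 → ℝ := fun x a => if a = x then 1 else 0
/-- The single-party deterministic behaviour outputting `a = 1 - x`. -/
def t3 : Fin 2 → Fin 2 → ℝ := fun x a => if a = 1 - x then 1 else 0
/-- The single-party deterministic behaviour always outputting 1. -/
def t4 : Fin 2 → Fin 2 → ℝ := fun _ a => if a = 1 then 1 else 0

/-- Tripartite product of three single-party behaviours. -/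
def prod3 (u v w : Fin 2 → Fin 2 → ℝ) :
    (Fin 3 → Fin 2) → (Fin 3 → Fin 2) → ℝ :=
  fun x a => u (x 0) (a 0) * v (x 1) (a 1) * w (x 2) (a 2)

/-- The eight product states. -/
def sStates : Fin 8 → (Fin 3 → Fin 2) → (Fin 3 → Fin 2) → ℝ :=
  ![prod3 t3 t4 t2, prod3 t1 t4 t2, prod3 t4 t2 t3, prod3 t4 t2 t1,
    prod3 t1 t1 t3, prod3 t1 t3 t1, prod3 t3 t1 t4, prod3 t3 t1 t2]

/-- Standard basis vector at the (input, output) pair `(x₀, a₀)`. -/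
def sbv (x₀ a₀ : Fin 3 → Fin 2) : (Fin 3 → Fin 2) → (Fin 3 → Fin 2) → ℝ :=
  fun x a => if x = x₀ ∧ a = a₀ then 1 else 0

/-- The eight effects of the distinguishing measurement. -/
def eMeas : Fin 8 → (Fin 3 → Fin 2) → (Fin 3 → Fin 2) → ℝ :=
  ![sbv ![0,0,0] ![1,1,0], sbv ![0,0,1] ![0,1,1], sbv ![0,1,0] ![1,1,1],
    sbv ![1,0,0] ![1,0,0], sbv ![0,0,0] ![0,0,1], sbv ![0,0,1] ![0,1,0],
    sbv ![0,1,0] ![1,0,1], sbv ![1,0,0] ![0,0,0]]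

/-- The product of three normalised non-negative single-party behaviours is a no-signalling
state. -/
lemma SNS_prod3 {u v w : Fin 2 → Fin 2 → ℝ}
    (hu : (∀ x a, 0 ≤ u x a) ∧ ∀ x, ∑ a, u x a = 1)
    (hv : (∀ x a, 0 ≤ v x a) ∧ ∀ x, ∑ a, v x a = 1)
    (hw : (∀ x a, 0 ≤ w x a) ∧ ∀ x, ∑ a, w x a = 1) : SNS 3 2 2 (prod3 u v w) := by
  refine ⟨?_, fun x a => ?_, fun x => ?_⟩
  · intro i x x' h a
    fin_cases i
    · have h1 := h 1 (by decide)
      have h2 := h 2 (by decide)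
      simp [prod3, h1, h2, ← Finset.sum_mul, -Fin.sum_univ_two, hu.2]
    · have h0 := h 0 (by decide)
      have h2 := h 2 (by decide)
      simp [prod3, h0, h2, ← Finset.sum_mul, ← Finset.mul_sum, -Fin.sum_univ_two, hv.2]
    · have h0 := h 0 (by decide)
      have h1 := h 1 (by decide)
      simp [prod3, h0, h1, ← Finset.mul_sum, -Fin.sum_univ_two, hw.2]
  · exact mul_nonneg (mul_nonneg (hu.1 _ _) (hv.1 _ _)) (hw.1 _ _)
  · have h := Fintype.prod_sum fun (i : Fin 3) (a : Fin 2) => (![u, v, w] i) (x i) a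
    simp only [Fin.prod_univ_three] at h
    exact h.symm.trans (by simp [-Fin.sum_univ_two, hu.2, hv.2, hw.2])

lemma t1_behaviour : (∀ x a, 0 ≤ t1 x a) ∧ ∀ x, ∑ a, t1 x a = 1 :=
  ⟨fun x a => by unfold t1; positivity, fun x => by simp only [t1, sum_ite_eq', mem_univ, if_true]⟩

lemma t2_behaviour : (∀ x a, 0 ≤ t2 x a) ∧ ∀ x, ∑ a, t2 x a = 1 :=
  ⟨fun x a => by unfold t2; positivity, fun x => by simp only [t2, sum_ite_eq', mem_univ, if_true]⟩

lemma t3_behaviour : (∀ x a, 0 ≤ t3 x a) ∧ ∀ x, ∑ a, t3 x a = 1 :=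
  ⟨fun x a => by unfold t3; positivity, fun x => by simp only [t3, sum_ite_eq', mem_univ, if_true]⟩

lemma t4_behaviour : (∀ x a, 0 ≤ t4 x a) ∧ ∀ x, ∑ a, t4 x a = 1 :=
  ⟨fun x a => by unfold t4; positivity, fun x => by simp only [t4, sum_ite_eq', mem_univ, if_true]⟩

lemma ip_sbv (x₀ a₀ : Fin 3 → Fin 2) (P : (Fin 3 → Fin 2) → (Fin 3 → Fin 2) → ℝ) :
    ip (sbv x₀ a₀) P = P x₀ a₀ := by
  simp [ip, sbv, ite_and]

lemma ip_sum_left {ι : Type*} (s : Finset ι) (e : ι → (Fin 3 → Fin 2) → (Fin 3 → Fin 2) → ℝ)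
    (P : (Fin 3 → Fin 2) → (Fin 3 → Fin 2) → ℝ) :
    ip (∑ i ∈ s, e i) P = ∑ i ∈ s, ip (e i) P := by
  simp only [ip, Finset.sum_apply, Finset.sum_mul]
  rw [Finset.sum_comm]
  simp_rw [Finset.sum_comm (s := s)]
  rw [Finset.sum_comm]

lemma isEffect_sbv (x₀ a₀ : Fin 3 → Fin 2) : IsEffect 3 2 2 (sbv x₀ a₀) := by
  rintro P ⟨-, hpos, hsum⟩
  rw [ip_sbv]
  exact ⟨hpos _ _, hsum x₀ ▸ Finset.single_le_sum (fun a _ => hpos x₀ a) (mem_univ a₀)⟩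

lemma sum_fin_three_two (f : (Fin 3 → Fin 2) → ℝ) :
    ∑ a, f a = f ![0,0,0] + f ![0,0,1] + f ![0,1,0] + f ![0,1,1]
      + f ![1,0,0] + f ![1,0,1] + f ![1,1,0] + f ![1,1,1] := by
  have h : (univ : Finset (Fin 3 → Fin 2)) = {![0,0,0], ![0,0,1], ![0,1,0], ![0,1,1],
      ![1,0,0], ![1,0,1], ![1,1,0], ![1,1,1]} := by decide
  rw [h]
  repeat rw [Finset.sum_insert (by decide)]
  rw [Finset.sum_singleton]
  ring

/-- Moving each of the pairs of outcomes measured at inputs `001`, `010`, `100` to the input `000`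
by no-signalling turns the eight outcome probabilities into the full distribution at `000`. -/
lemma ip_sum_eMeas {P : (Fin 3 → Fin 2) → (Fin 3 → Fin 2) → ℝ} (hP : SNS 3 2 2 P) :
    ip (∑ i : Fin 8, eMeas i) P = 1 := by
  obtain ⟨hns, -, hsum⟩ := hP
  have h0 := hns 0 ![1,0,0] ![0,0,0] (by decide) ![0,0,0]
  have h1 := hns 1 ![0,1,0] ![0,0,0] (by decide) ![1,0,1]
  have h2 := hns 2 ![0,0,1] ![0,0,0] (by decide) ![0,1,0]
  have u0 (b : Fin 2) : Function.update ![(0 : Fin 2),0,0] 0 b = ![b,0,0] := by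
    revert b; decide
  have u1 (b : Fin 2) : Function.update ![(1 : Fin 2),0,1] 1 b = ![1,b,1] := by
    revert b; decide
  have u2 (b : Fin 2) : Function.update ![(0 : Fin 2),1,0] 2 b = ![0,1,b] := by
    revert b; decide
  simp only [u0, Fin.sum_univ_two] at h0
  simp only [u1, Fin.sum_univ_two] at h1
  simp only [u2, Fin.sum_univ_two] at h2
  have hn := hsum ![0,0,0]
  rw [sum_fin_three_two] at hn
  rw [ip_sum_left, Fin.sum_univ_eight]
  change ip (sbv _ _) P + ip (sbv _ _) P + ip (sbv _ _) P + ip (sbv _ _) P + ip (sbv _ _) P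
    + ip (sbv _ _) P + ip (sbv _ _) P + ip (sbv _ _) P = 1
  simp only [ip_sbv]
  linarith

theorem nonlocality_without_entanglement_in_boxworld :
    (∀ i : Fin 8, SNS 3 2 2 (sStates i)) ∧
    (∀ i : Fin 8, IsEffect 3 2 2 (eMeas i)) ∧
    (∀ P, SNS 3 2 2 P → ip (∑ i : Fin 8, eMeas i) P = 1) ∧
    (∀ i j : Fin 8, ip (eMeas i) (sStates j) = if i = j then 1 else 0) := by
  refine ⟨fun i => ?_, fun i => ?_, fun P => ip_sum_eMeas, fun i j => ?_⟩
  · fin_cases i <;> apply SNS_prod3 <;>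
      first
      | exact t1_behaviour
      | exact t2_behaviour
      | exact t3_behaviour
      | exact t4_behaviour
  · fin_cases i <;> exact isEffect_sbv _ _
  · fin_cases i <;> fin_cases j <;>
      simp [eMeas, sStates, ip_sbv, prod3, t1, t2, t3, t4]
end

section
/- Let ŝ be the cross-section-I state ŝ = ω·P^NL₁ + (η/2)(P^L₁ + P^L₆) + (1 − ω − η)·P^O, with η, ω ≥ 0 and η + ω ≤ 1. Then: (i) CHSH(ŝ) = 2(1 + ω); and (ii) the distilled bipartite behaviour P' obtained by applying the effects e₀, e₁ (for Alice) and f₀, f₁ (for Bob) to three copies of ŝ satisfies CHSH(P') = (1/32)·[7ω³ − 15η³ + 33ω² + 57ω + 3η²(7 + 11ω) + 3η(9 + 26ω + 13ω²) + 31]. -/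
open Finset

/-- The PR box `P^NL₁(ab|xy) = ½·1[a⊕b = x·y]` (arguments in order a b x y). -/
noncomputable def PNL1 : Fin 2 → Fin 2 → Fin 2 → Fin 2 → ℝ :=
  fun a b x y => if a + b = x * y then 1 / 2 else 0

/-- The anti-PR box `P^NL₂(ab|xy) = ½·1[a⊕b = x·y ⊕ 1]`. -/
noncomputable def PNL2 : Fin 2 → Fin 2 → Fin 2 → Fin 2 → ℝ :=
  fun a b x y => if a + b = x * y + 1 then 1 / 2 else 0

/-- The local box `P^L₁(ab|xy) = 1[a = 0]·1[b = 0]`. -/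
def PL1 : Fin 2 → Fin 2 → Fin 2 → Fin 2 → ℝ :=
  fun a b _ _ => if a = 0 ∧ b = 0 then 1 else 0

/-- The local box `P^L₆(ab|xy) = 1[a = 1]·1[b = 1]`. -/
def PL6 : Fin 2 → Fin 2 → Fin 2 → Fin 2 → ℝ :=
  fun a b _ _ => if a = 1 ∧ b = 1 then 1 else 0

/-- The local box `P^L₉(ab|xy) = 1[a = x]·1[b = 0]`. -/
def PL9 : Fin 2 → Fin 2 → Fin 2 → Fin 2 → ℝ :=
  fun a b x _ => if a = x ∧ b = 0 then 1 else 0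

/-- The local box `P^O = ¾·P^NL₁ + ¼·P^NL₂`. -/
noncomputable def PO : Fin 2 → Fin 2 → Fin 2 → Fin 2 → ℝ :=
  fun a b x y => 3 / 4 * PNL1 a b x y + 1 / 4 * PNL2 a b x y

/-- The correlator `E_xy(P) = ∑_{a,b} (−1)^(a⊕b) P(ab|xy)`. -/
def Exy (P : Fin 2 → Fin 2 → Fin 2 → Fin 2 → ℝ) (x y : Fin 2) : ℝ :=
  ∑ a : Fin 2, ∑ b : Fin 2, (if a = b then (1 : ℝ) else -1) * P a b x y

/-- The CHSH value of a bipartite behaviour. -/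
def CHSH (P : Fin 2 → Fin 2 → Fin 2 → Fin 2 → ℝ) : ℝ :=
  Exy P 0 0 + Exy P 0 1 + Exy P 1 0 - Exy P 1 1

/-- The contraction of two tripartite vectors against three copies of a
bipartite behaviour. -/
def contra (g h : (Fin 3 → Fin 2) → (Fin 3 → Fin 2) → ℝ)
    (s : Fin 2 → Fin 2 → Fin 2 → Fin 2 → ℝ) : ℝ :=
  ∑ x : Fin 3 → Fin 2, ∑ a : Fin 3 → Fin 2, ∑ y : Fin 3 → Fin 2, ∑ b : Fin 3 → Fin 2,
    g x a * h y b * ∏ i : Fin 3, s (a i) (b i) (x i) (y i)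

/-- The indicator vector of a list of (input tuple, output tuple) pairs. -/
def ind (l : List ((Fin 3 → Fin 2) × (Fin 3 → Fin 2))) :
    (Fin 3 → Fin 2) → (Fin 3 → Fin 2) → ℝ :=
  fun x a => if (x, a) ∈ l then 1 else 0

def eA0 : (Fin 3 → Fin 2) → (Fin 3 → Fin 2) → ℝ :=
  ind [(![0,0,0], ![0,0,0]), (![0,0,0], ![0,1,1]), (![0,0,0], ![1,0,1]), (![0,0,0], ![1,1,0])]
def eA0c : (Fin 3 → Fin 2) → (Fin 3 → Fin 2) → ℝ :=
  ind [(![0,0,0], ![0,0,1]), (![0,0,0], ![0,1,0]), (![0,0,0], ![1,0,0]), (![0,0,0], ![1,1,1])]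
def eA1 : (Fin 3 → Fin 2) → (Fin 3 → Fin 2) → ℝ :=
  ind [(![0,1,1], ![1,1,1]), (![1,0,1], ![1,0,0]), (![1,1,0], ![0,0,1]), (![1,1,1], ![0,1,0])]
def eA1c : (Fin 3 → Fin 2) → (Fin 3 → Fin 2) → ℝ :=
  ind [(![0,1,1], ![0,1,1]), (![1,0,1], ![1,1,0]), (![1,1,0], ![0,0,0]), (![1,1,1], ![1,0,1])]
def fB0 : (Fin 3 → Fin 2) → (Fin 3 → Fin 2) → ℝ := eA1c
def fB0c : (Fin 3 → Fin 2) → (Fin 3 → Fin 2) → ℝ := eA1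
def fB1 : (Fin 3 → Fin 2) → (Fin 3 → Fin 2) → ℝ :=
  ind [(![0,0,0], ![1,0,1]), (![0,0,1], ![0,0,0]), (![0,1,0], ![1,1,0]), (![1,0,0], ![0,1,1])]
def fB1c : (Fin 3 → Fin 2) → (Fin 3 → Fin 2) → ℝ :=
  ind [(![0,0,0], ![0,1,0]), (![0,0,1], ![0,0,1]), (![0,1,0], ![1,0,0]), (![1,0,0], ![1,1,1])]

/-- Alice's tripartite effect for input `x` and outcome `a`. -/
def aliceEff (x a : Fin 2) : (Fin 3 → Fin 2) → (Fin 3 → Fin 2) → ℝ :=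
  if x = 0 then (if a = 0 then eA0 else eA0c) else (if a = 0 then eA1 else eA1c)

/-- Bob's tripartite effect for input `y` and outcome `b`. -/
def bobEff (y b : Fin 2) : (Fin 3 → Fin 2) → (Fin 3 → Fin 2) → ℝ :=
  if y = 0 then (if b = 0 then fB0 else fB0c) else (if b = 0 then fB1 else fB1c)

/-- The distilled bipartite behaviour obtained from three copies of `s`. -/
def distilled (s : Fin 2 → Fin 2 → Fin 2 → Fin 2 → ℝ) :
    Fin 2 → Fin 2 → Fin 2 → Fin 2 → ℝ :=
  fun a b x y => contra (aliceEff x a) (bobEff y b) s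

/-- Contracting the indicator vectors of two duplicate-free lists sums over the listed pairs. -/
theorem contra_ind {l m : List ((Fin 3 → Fin 2) × (Fin 3 → Fin 2))} (hl : l.Nodup) (hm : m.Nodup)
    (s : Fin 2 → Fin 2 → Fin 2 → Fin 2 → ℝ) :
    contra (ind l) (ind m) s =
      (l.map fun p => (m.map fun q => ∏ i : Fin 3, s (p.2 i) (q.2 i) (p.1 i) (q.1 i)).sum).sum := by
  have sum_ind : ∀ {k : List ((Fin 3 → Fin 2) × (Fin 3 → Fin 2))}, k.Nodup →
      ∀ f : (Fin 3 → Fin 2) × (Fin 3 → Fin 2) → ℝ,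
        ∑ x, ∑ a, ind k x a * f (x, a) = (k.map f).sum := by
    intro k hk f
    rw [← List.sum_toFinset f hk,
      ← Fintype.sum_prod_type' (fun x a => ind k x a * f (x, a))]
    simp [ind, ← List.mem_toFinset]
  rw [← sum_ind hl]
  refine Finset.sum_congr rfl fun x _ => Finset.sum_congr rfl fun a _ => ?_
  rw [← sum_ind hm]
  simp only [Finset.mul_sum, mul_assoc]

/-- The entries of the cross-section state depend only on whether `a = b` and whether `x * y = 0`. -/
theorem crossSection_apply (ω η : ℝ) (a b x y : Fin 2) :
    ω * PNL1 a b x y + η / 2 * (PL1 a b x y + PL6 a b x y) + (1 - ω - η) * PO a b x y =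
      if a = b then
        if x * y = 0 then (3 + ω + η) / 8 else (1 - ω + 3 * η) / 8
      else
        if x * y = 0 then (1 - ω - η) / 8 else (3 + ω - 3 * η) / 8 := by
  have one_add_one : (1 : Fin 2) + 1 = 0 := rfl
  fin_cases a <;> fin_cases b <;> fin_cases x <;> fin_cases y <;>
    norm_num [PNL1, PL1, PL6, PO, PNL2, one_add_one] <;> ring

theorem distillation_cross_section_I (ω η : ℝ)
    (hω : 0 ≤ ω) (hη : 0 ≤ η) (hsum : η + ω ≤ 1)
    (shat : Fin 2 → Fin 2 → Fin 2 → Fin 2 → ℝ)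
    (hshat : shat = fun a b x y =>
      ω * PNL1 a b x y + η / 2 * (PL1 a b x y + PL6 a b x y) +
        (1 - ω - η) * PO a b x y) :
    CHSH shat = 2 * (1 + ω) ∧
    CHSH (distilled shat) =
      (1 / 32) * (7 * ω ^ 3 - 15 * η ^ 3 + 33 * ω ^ 2 + 57 * ω +
        3 * η ^ 2 * (7 + 11 * ω) + 3 * η * (9 + 26 * ω + 13 * ω ^ 2) + 31) := by
  have hs : shat = fun a b x y => _ := hshat.trans <| by
    funext a b x y
    exact crossSection_apply ω η a b x y
  constructor
  · simp only [CHSH, Exy, hs, Fin.sum_univ_two]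
    norm_num
    ring
  · simp only [CHSH, Exy, distilled, aliceEff, bobEff, Fin.sum_univ_two, fB0, fB0c, eA0, eA0c,
      eA1, eA1c, fB1, fB1c, reduceIte, one_ne_zero, zero_ne_one]
    repeat rw [contra_ind (by decide) (by decide)]
    simp [Fin.prod_univ_three, hs]
    ring
end
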